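/- Let D, A₁,…,A_m ∈ Sym(n), b ∈ ℝ^m, μ > 0, τ > 0, and define 𝒜(X)_i = ⟨A_i,X⟩, r(U) = 𝒜(UUᵀ) − b, and L(U) = ⟨D, UUᵀ⟩ + μ‖r(U)‖₂² for U ∈ ℝ^{n×k}. Then on the set {U ∈ ℝ^{n×k} : ‖U‖_F ≤ τ}, the gradient of L is Lipschitz continuous with constant l = 2‖D‖₂ + 4μ‖𝒜‖‖b‖₂ + 12μτ²‖𝒜‖², i.e., ‖∇L(U₁) − ∇L(U₂)‖_F ≤ l·‖U₁ − U₂‖_F for all U₁, U₂ in this set. -/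

import Mathlib

open Matrix

/-- Trace inner product `⟨A, B⟩ = Tr(Aᵀ B)` on square matrices. -/
noncomputable def mip {n : ℕ} (A B : Matrix (Fin n) (Fin n) ℝ) : ℝ := (Aᵀ * B).trace

/-- Euclidean norm of a vector. -/
noncomputable def vnorm {k : ℕ} (z : Fin k → ℝ) : ℝ := Real.sqrt (∑ i, z i ^ 2)

/-- Frobenius norm of a matrix. -/
noncomputable def fnorm {n k : ℕ} (A : Matrix (Fin n) (Fin k) ℝ) : ℝ :=
  Real.sqrt (∑ i, ∑ j, A i j ^ 2)

/-- Operator norm `‖𝒜‖ = max{‖𝒜(Y)‖₂ : Y ∈ Sym(n), ‖Y‖_F ≤ 1}` of `𝒜(X)ᵢ = ⟨Aᵢ, X⟩`. -/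
noncomputable def opA {n m : ℕ} (A : Fin m → Matrix (Fin n) (Fin n) ℝ) : ℝ :=
  sSup {t | ∃ Y : Matrix (Fin n) (Fin n) ℝ, Y.IsSymm ∧ fnorm Y ≤ 1 ∧
    t = vnorm (fun i => mip (A i) Y)}

/-- Spectral norm `‖D‖₂ = max_{‖x‖₂ = 1} ‖D x‖₂`. -/
noncomputable def specNorm {n : ℕ} (D : Matrix (Fin n) (Fin n) ℝ) : ℝ :=
  sSup {t | ∃ x : Fin n → ℝ, vnorm x = 1 ∧ t = vnorm (D.mulVec x)}

/-- The gradient `∇L(U) = [2D + 4μ𝒜*(r(U))]U` of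
`L(U) = ⟨D, UUᵀ⟩ + μ‖𝒜(UUᵀ) − b‖₂²`. -/
noncomputable def gradL {n m k : ℕ} (D : Matrix (Fin n) (Fin n) ℝ)
    (A : Fin m → Matrix (Fin n) (Fin n) ℝ) (b : Fin m → ℝ) (μ : ℝ)
    (U : Matrix (Fin n) (Fin k) ℝ) : Matrix (Fin n) (Fin k) ℝ :=
  ((2 : ℝ) • D + (4 * μ) • ∑ i, (mip (A i) (U * Uᵀ) - b i) • A i) * U

section FrobeniusNorm

open scoped Matrix.Norms.Frobenius

lemma fnorm_eq_norm {n k : ℕ} (A : Matrix (Fin n) (Fin k) ℝ) : fnorm A = ‖A‖ := by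
  rw [fnorm, Matrix.frobenius_norm_def, Real.sqrt_eq_rpow]
  simp [Real.norm_eq_abs]

lemma fnorm_add_le {n k : ℕ} (A B : Matrix (Fin n) (Fin k) ℝ) :
    fnorm (A + B) ≤ fnorm A + fnorm B := by
  simpa only [fnorm_eq_norm] using norm_add_le A B

lemma fnorm_sub_le {n k : ℕ} (A B : Matrix (Fin n) (Fin k) ℝ) :
    fnorm (A - B) ≤ fnorm A + fnorm B := by
  simpa only [fnorm_eq_norm] using norm_sub_le A B

lemma fnorm_smul {n k : ℕ} (c : ℝ) (A : Matrix (Fin n) (Fin k) ℝ) :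
    fnorm (c • A) = |c| * fnorm A := by
  simpa only [fnorm_eq_norm, Real.norm_eq_abs] using norm_smul c A

lemma fnorm_mul_le {n k l : ℕ} (A : Matrix (Fin n) (Fin k) ℝ) (B : Matrix (Fin k) (Fin l) ℝ) :
    fnorm (A * B) ≤ fnorm A * fnorm B := by
  simpa only [fnorm_eq_norm] using Matrix.frobenius_norm_mul A B

lemma fnorm_transpose {n k : ℕ} (A : Matrix (Fin n) (Fin k) ℝ) : fnorm Aᵀ = fnorm A := by
  simpa only [fnorm_eq_norm] using Matrix.frobenius_norm_transpose A

end FrobeniusNorm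

lemma fnorm_nonneg {n k : ℕ} (A : Matrix (Fin n) (Fin k) ℝ) : 0 ≤ fnorm A :=
  Real.sqrt_nonneg _

lemma fnorm_sq {n k : ℕ} (A : Matrix (Fin n) (Fin k) ℝ) :
    fnorm A ^ 2 = ∑ i, ∑ j, A i j ^ 2 :=
  Real.sq_sqrt (by positivity)

lemma vnorm_nonneg {k : ℕ} (z : Fin k → ℝ) : 0 ≤ vnorm z :=
  Real.sqrt_nonneg _

lemma vnorm_sq {k : ℕ} (z : Fin k → ℝ) : vnorm z ^ 2 = ∑ i, z i ^ 2 :=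
  Real.sq_sqrt (by positivity)

lemma vnorm_smul {k : ℕ} (c : ℝ) (z : Fin k → ℝ) : vnorm (c • z) = |c| * vnorm z := by
  rw [← abs_of_nonneg (vnorm_nonneg (c • z)), ← abs_of_nonneg (vnorm_nonneg z), ← abs_mul,
    ← sq_eq_sq_iff_abs_eq_abs, mul_pow, vnorm_sq, vnorm_sq]
  simp [mul_pow, Finset.mul_sum]

lemma sum_mul_le_vnorm_mul_vnorm {k : ℕ} (x y : Fin k → ℝ) :
    ∑ i, x i * y i ≤ vnorm x * vnorm y :=
  Real.sum_mul_le_sqrt_mul_sqrt _ _ _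

lemma vnorm_mulVec_le_fnorm {n k : ℕ} (D : Matrix (Fin n) (Fin k) ℝ) (x : Fin k → ℝ) :
    vnorm (D *ᵥ x) ≤ fnorm D * vnorm x := by
  refine (sq_le_sq₀ (vnorm_nonneg _) (mul_nonneg (fnorm_nonneg D) (vnorm_nonneg x))).mp ?_
  rw [mul_pow, vnorm_sq, vnorm_sq, fnorm_sq, Finset.sum_mul]
  exact Finset.sum_le_sum fun i _ => Finset.sum_mul_sq_le_sq_mul_sq Finset.univ (D i) x

lemma vnorm_mulVec_le_specNorm {n : ℕ} (D : Matrix (Fin n) (Fin n) ℝ) (x : Fin n → ℝ) :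
    vnorm (D *ᵥ x) ≤ specNorm D * vnorm x := by
  rcases (vnorm_nonneg x).eq_or_lt with hx | hx
  · have := vnorm_mulVec_le_fnorm D x
    rwa [← hx, mul_zero] at this ⊢
  have hbdd : BddAbove {t | ∃ x : Fin n → ℝ, vnorm x = 1 ∧ t = vnorm (D.mulVec x)} := by
    refine ⟨fnorm D, ?_⟩
    rintro t ⟨y, hy, rfl⟩
    simpa [hy] using vnorm_mulVec_le_fnorm D y
  have habs : |(vnorm x)⁻¹| = (vnorm x)⁻¹ := abs_of_pos (inv_pos.mpr hx)
  have hle : vnorm (D *ᵥ ((vnorm x)⁻¹ • x)) ≤ specNorm D :=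
    le_csSup hbdd ⟨_, by rw [vnorm_smul, habs, inv_mul_cancel₀ hx.ne'], rfl⟩
  rwa [Matrix.mulVec_smul, vnorm_smul, habs, inv_mul_le_iff₀ hx, mul_comm] at hle

lemma specNorm_nonneg {n : ℕ} (D : Matrix (Fin n) (Fin n) ℝ) : 0 ≤ specNorm D := by
  refine Real.sSup_nonneg ?_
  rintro t ⟨y, -, rfl⟩
  exact vnorm_nonneg _

lemma fnorm_mul_le_specNorm {n k : ℕ} (D : Matrix (Fin n) (Fin n) ℝ)
    (M : Matrix (Fin n) (Fin k) ℝ) : fnorm (D * M) ≤ specNorm D * fnorm M := by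
  refine (sq_le_sq₀ (fnorm_nonneg _) (mul_nonneg (specNorm_nonneg D) (fnorm_nonneg M))).mp ?_
  rw [mul_pow, fnorm_sq, fnorm_sq, Finset.sum_comm, Finset.sum_comm (f := fun i j => M i j ^ 2),
    Finset.mul_sum]
  refine Finset.sum_le_sum fun j _ => ?_
  have h := pow_le_pow_left₀ (vnorm_nonneg _) (vnorm_mulVec_le_specNorm D fun i => M i j) 2
  rwa [mul_pow, vnorm_sq, vnorm_sq] at h

lemma mip_eq_sum {n : ℕ} (A B : Matrix (Fin n) (Fin n) ℝ) :
    mip A B = ∑ i, ∑ j, A i j * B i j := by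
  rw [Finset.sum_comm]
  rfl

lemma mip_self {n : ℕ} (A : Matrix (Fin n) (Fin n) ℝ) : mip A A = fnorm A ^ 2 := by
  rw [mip_eq_sum, fnorm_sq]
  simp only [sq]

lemma mip_sub_right {n : ℕ} (A B C : Matrix (Fin n) (Fin n) ℝ) :
    mip A (B - C) = mip A B - mip A C := by
  simp [mip, Matrix.mul_sub]

lemma mip_smul_right {n : ℕ} (c : ℝ) (A B : Matrix (Fin n) (Fin n) ℝ) :
    mip A (c • B) = c * mip A B := by
  simp [mip]

lemma mip_sum_smul_left {n m : ℕ} (A : Fin m → Matrix (Fin n) (Fin n) ℝ) (y : Fin m → ℝ)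
    (B : Matrix (Fin n) (Fin n) ℝ) : mip (∑ i, y i • A i) B = ∑ i, y i * mip (A i) B := by
  simp [mip, Matrix.transpose_sum, Matrix.sum_mul, Matrix.trace_sum]

lemma mip_sq_le {n : ℕ} (A B : Matrix (Fin n) (Fin n) ℝ) :
    mip A B ^ 2 ≤ fnorm A ^ 2 * fnorm B ^ 2 := by
  simp only [mip_eq_sum, fnorm_sq, ← Fintype.sum_prod_type']
  exact Finset.sum_mul_sq_le_sq_mul_sq _ _ _

lemma opA_nonneg {n m : ℕ} (A : Fin m → Matrix (Fin n) (Fin n) ℝ) : 0 ≤ opA A := by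
  refine Real.sSup_nonneg ?_
  rintro t ⟨Y, -, -, rfl⟩
  exact vnorm_nonneg _

lemma vnorm_mip_le_vnorm_fnorm {n m : ℕ} (A : Fin m → Matrix (Fin n) (Fin n) ℝ)
    (Y : Matrix (Fin n) (Fin n) ℝ) :
    vnorm (fun i => mip (A i) Y) ≤ vnorm (fun i => fnorm (A i)) * fnorm Y := by
  refine (sq_le_sq₀ (vnorm_nonneg _) (mul_nonneg (vnorm_nonneg _) (fnorm_nonneg Y))).mp ?_
  rw [mul_pow, vnorm_sq, vnorm_sq, Finset.sum_mul]
  exact Finset.sum_le_sum fun i _ => mip_sq_le _ _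

lemma vnorm_mip_le_opA {n m : ℕ} (A : Fin m → Matrix (Fin n) (Fin n) ℝ)
    {Y : Matrix (Fin n) (Fin n) ℝ} (hY : Y.IsSymm) :
    vnorm (fun i => mip (A i) Y) ≤ opA A * fnorm Y := by
  rcases (fnorm_nonneg Y).eq_or_lt with h0 | h0
  · have := vnorm_mip_le_vnorm_fnorm A Y
    rwa [← h0, mul_zero] at this ⊢
  have hbdd : BddAbove {t | ∃ Y : Matrix (Fin n) (Fin n) ℝ, Y.IsSymm ∧ fnorm Y ≤ 1 ∧
      t = vnorm (fun i => mip (A i) Y)} := by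
    refine ⟨vnorm fun i => fnorm (A i), ?_⟩
    rintro t ⟨Z, -, hZ, rfl⟩
    exact (vnorm_mip_le_vnorm_fnorm A Z).trans (mul_le_of_le_one_right (vnorm_nonneg _) hZ)
  have habs : |(fnorm Y)⁻¹| = (fnorm Y)⁻¹ := abs_of_pos (inv_pos.mpr h0)
  have hle : vnorm (fun i => mip (A i) ((fnorm Y)⁻¹ • Y)) ≤ opA A :=
    le_csSup hbdd ⟨_, hY.smul _, by rw [fnorm_smul, habs, inv_mul_cancel₀ h0.ne'], rfl⟩
  have hsmul : (fun i => mip (A i) ((fnorm Y)⁻¹ • Y)) = (fnorm Y)⁻¹ • fun i => mip (A i) Y := by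
    funext i
    exact mip_smul_right _ _ _
  rwa [hsmul, vnorm_smul, habs, inv_mul_le_iff₀ h0, mul_comm] at hle

lemma fnorm_sum_smul_le_opA {n m : ℕ} {A : Fin m → Matrix (Fin n) (Fin n) ℝ}
    (hA : ∀ i, (A i).IsSymm) (y : Fin m → ℝ) :
    fnorm (∑ i, y i • A i) ≤ opA A * vnorm y := by
  have hS : (∑ i, y i • A i).IsSymm := by
    simp [Matrix.IsSymm, Matrix.transpose_sum, fun i => (hA i).eq]
  rcases (fnorm_nonneg (∑ i, y i • A i)).eq_or_lt with h0 | h0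
  · rw [← h0]
    exact mul_nonneg (opA_nonneg A) (vnorm_nonneg y)
  refine le_of_mul_le_mul_right ?_ h0
  calc fnorm (∑ i, y i • A i) * fnorm (∑ i, y i • A i)
      = ∑ i, y i * mip (A i) (∑ i, y i • A i) := by
        rw [← sq, ← mip_self, mip_sum_smul_left]
    _ ≤ vnorm y * vnorm fun i => mip (A i) (∑ i, y i • A i) := sum_mul_le_vnorm_mul_vnorm _ _
    _ ≤ vnorm y * (opA A * fnorm (∑ i, y i • A i)) :=
        mul_le_mul_of_nonneg_left (vnorm_mip_le_opA A hS) (vnorm_nonneg y)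
    _ = opA A * vnorm y * fnorm (∑ i, y i • A i) := by ring

lemma fnorm_sum_mip_smul_le {n m : ℕ} {A : Fin m → Matrix (Fin n) (Fin n) ℝ}
    (hA : ∀ i, (A i).IsSymm) {Y : Matrix (Fin n) (Fin n) ℝ} (hY : Y.IsSymm) :
    fnorm (∑ i, mip (A i) Y • A i) ≤ opA A ^ 2 * fnorm Y :=
  calc fnorm (∑ i, mip (A i) Y • A i)
      ≤ opA A * vnorm fun i => mip (A i) Y := fnorm_sum_smul_le_opA hA _
    _ ≤ opA A * (opA A * fnorm Y) :=
        mul_le_mul_of_nonneg_left (vnorm_mip_le_opA A hY) (opA_nonneg A)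
    _ = opA A ^ 2 * fnorm Y := by ring

lemma isSymm_mul_transpose {n k : ℕ} (U : Matrix (Fin n) (Fin k) ℝ) : (U * Uᵀ).IsSymm := by
  rw [Matrix.IsSymm, Matrix.transpose_mul, Matrix.transpose_transpose]

lemma fnorm_mul_transpose_self_le {n k : ℕ} (U : Matrix (Fin n) (Fin k) ℝ) :
    fnorm (U * Uᵀ) ≤ fnorm U ^ 2 := by
  simpa only [fnorm_transpose, sq] using fnorm_mul_le U Uᵀ

lemma fnorm_mul_transpose_self_sub_le {n k : ℕ} (U V : Matrix (Fin n) (Fin k) ℝ) :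
    fnorm (U * Uᵀ - V * Vᵀ) ≤ (fnorm U + fnorm V) * fnorm (U - V) :=
  calc fnorm (U * Uᵀ - V * Vᵀ) = fnorm (U * (U - V)ᵀ + (U - V) * Vᵀ) := by
        congr 1
        rw [Matrix.transpose_sub, Matrix.mul_sub, Matrix.sub_mul]
        abel
    _ ≤ fnorm U * fnorm (U - V)ᵀ + fnorm (U - V) * fnorm Vᵀ :=
        (fnorm_add_le _ _).trans (add_le_add (fnorm_mul_le _ _) (fnorm_mul_le _ _))
    _ = (fnorm U + fnorm V) * fnorm (U - V) := by
        rw [fnorm_transpose, fnorm_transpose]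
        ring

lemma gradL_sub {n m k : ℕ} (D : Matrix (Fin n) (Fin n) ℝ)
    (A : Fin m → Matrix (Fin n) (Fin n) ℝ) (b : Fin m → ℝ) (μ : ℝ)
    (U V : Matrix (Fin n) (Fin k) ℝ) :
    gradL D A b μ U - gradL D A b μ V =
      (2 : ℝ) • (D * (U - V)) + (4 * μ) •
        ((∑ i, mip (A i) (U * Uᵀ) • A i) * (U - V) +
          (∑ i, mip (A i) (U * Uᵀ - V * Vᵀ) • A i) * V - (∑ i, b i • A i) * (U - V)) := by
  simp only [gradL, mip_sub_right, sub_smul, Finset.sum_sub_distrib, Matrix.add_mul,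
    Matrix.smul_mul, Matrix.mul_sub, Matrix.sub_mul, smul_sub, smul_add]
  abel

/-- On `{U : ‖U‖_F ≤ τ}` the gradient of
`L(U) = ⟨D, UUᵀ⟩ + μ‖𝒜(UUᵀ) − b‖₂²` is Lipschitz with constant
`l = 2‖D‖₂ + 4μ‖𝒜‖‖b‖₂ + 12μτ²‖𝒜‖²`. -/
theorem gradient_lipschitz {n m k : ℕ}
    (D : Matrix (Fin n) (Fin n) ℝ) (hD : D.IsSymm)
    (A : Fin m → Matrix (Fin n) (Fin n) ℝ) (hA : ∀ i, (A i).IsSymm)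
    (b : Fin m → ℝ) (μ τ : ℝ) (hμ : 0 < μ) (hτ : 0 < τ) :
    ∀ U₁ U₂ : Matrix (Fin n) (Fin k) ℝ, fnorm U₁ ≤ τ → fnorm U₂ ≤ τ →
      fnorm (gradL D A b μ U₁ - gradL D A b μ U₂) ≤
        (2 * specNorm D + 4 * μ * opA A * vnorm b + 12 * μ * τ ^ 2 * opA A ^ 2) *
          fnorm (U₁ - U₂) := by
  intro U V hU hV
  have hΔ := fnorm_nonneg (U - V)
  have hU0 := fnorm_nonneg U
  have hV0 := fnorm_nonneg V
  have h₁ : fnorm ((∑ i, mip (A i) (U * Uᵀ) • A i) * (U - V)) ≤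
      opA A ^ 2 * τ ^ 2 * fnorm (U - V) := by
    refine (fnorm_mul_le _ _).trans (mul_le_mul_of_nonneg_right ?_ hΔ)
    refine (fnorm_sum_mip_smul_le hA (isSymm_mul_transpose U)).trans ?_
    gcongr
    exact (fnorm_mul_transpose_self_le U).trans (by gcongr)
  have h₂ : fnorm ((∑ i, mip (A i) (U * Uᵀ - V * Vᵀ) • A i) * V) ≤
      opA A ^ 2 * ((τ + τ) * fnorm (U - V)) * τ := by
    refine (fnorm_mul_le _ _).trans (mul_le_mul ?_ hV hV0 (by positivity))
    refine (fnorm_sum_mip_smul_le hA ((isSymm_mul_transpose U).sub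
      (isSymm_mul_transpose V))).trans ?_
    gcongr
    exact (fnorm_mul_transpose_self_sub_le U V).trans (by gcongr)
  have h₃ : fnorm ((∑ i, b i • A i) * (U - V)) ≤ opA A * vnorm b * fnorm (U - V) :=
    (fnorm_mul_le _ _).trans (mul_le_mul_of_nonneg_right (fnorm_sum_smul_le_opA hA b) hΔ)
  rw [gradL_sub]
  refine (fnorm_add_le _ _).trans ?_
  rw [fnorm_smul, fnorm_smul, abs_two, abs_of_pos (by positivity : (0 : ℝ) < 4 * μ)]
  calc _ ≤ 2 * (specNorm D * fnorm (U - V)) + 4 * μ * (opA A ^ 2 * τ ^ 2 * fnorm (U - V) +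
        opA A ^ 2 * ((τ + τ) * fnorm (U - V)) * τ + opA A * vnorm b * fnorm (U - V)) := by
        refine add_le_add (mul_le_mul_of_nonneg_left (fnorm_mul_le_specNorm D _) zero_le_two)
          (mul_le_mul_of_nonneg_left ?_ (by positivity))
        exact (fnorm_sub_le _ _).trans
          (add_le_add ((fnorm_add_le _ _).trans (add_le_add h₁ h₂)) h₃)
    _ = _ := by ring
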